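/- Assume the standard setup with r ≥ 2, and let 2 ≤ i ≤ r. Assume e + s·nᵢ ≥ c_r if i < r and e + s·nᵢ ≥ c_{r−1} if i = r, where s ≥ 1 if nᵢ = 1 and s ≥ 2 is even if nᵢ ≥ 2. If c₁ ≤ e < c₂, then s·nᵢ + t − r + b + 1 ≤ χ_la(G(Vᵢ,s)) ≤ s·nᵢ + t − r + 2. -/

import Mathlib

open Finset
open scoped Classical

namespace LocalAntimagic

variable {V : Type*}

/-- The induced vertex label: sum of the labels of edges incident to `v`. -/
noncomputable def vertexSum [Fintype V] (G : SimpleGraph V) (f : Sym2 V → ℕ) (v : V) : ℕ :=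
  ∑ e ∈ G.incidenceFinset v, f e

/-- `f` is a local antimagic labeling of `G`: a bijection from the edge set onto
`{1, …, |E|}` whose induced vertex labels distinguish adjacent vertices. -/
def IsLocalAntimagic [Fintype V] (G : SimpleGraph V) (f : Sym2 V → ℕ) : Prop :=
  Set.BijOn f G.edgeSet (Set.Icc 1 G.edgeFinset.card) ∧
  ∀ ⦃u v : V⦄, G.Adj u v → vertexSum G f u ≠ vertexSum G f v

/-- The color number `c(f)`: the number of distinct induced vertex labels. -/
noncomputable def colorCount [Fintype V] (G : SimpleGraph V) (f : Sym2 V → ℕ) : ℕ :=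
  (Finset.univ.image (vertexSum G f)).card

/-- The local antimagic chromatic number. -/
noncomputable def chiLA [Fintype V] (G : SimpleGraph V) : ℕ :=
  sInf {n | ∃ f, IsLocalAntimagic G f ∧ colorCount G f = n}

/-- A pendant vertex is a vertex of degree 1. -/
def IsPendant [Fintype V] (G : SimpleGraph V) (v : V) : Prop :=
  G.degree v = 1

/-- The number of pendant vertices of `G`. -/
noncomputable def pendantCount [Fintype V] (G : SimpleGraph V) : ℕ :=
  (Finset.univ.filter (fun v => IsPendant G v)).card

/-- `G(S, s)`: the graph obtained from `G` by attaching `s` new pendant edges to every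
vertex of `S`.  The new pendant vertex attached to `w ∈ S` via the `j`-th new edge is
`Sum.inr (w, j)`; the original graph lives on the `Sum.inl` vertices. -/
def attachPendants (G : SimpleGraph V) (S : Finset V) (s : ℕ) :
    SimpleGraph (V ⊕ (S × Fin s)) :=
  SimpleGraph.fromRel (fun a b =>
    (∃ u v : V, a = Sum.inl u ∧ b = Sum.inl v ∧ G.Adj u v) ∨
    (∃ (w : S) (j : Fin s), a = Sum.inl (w : V) ∧ b = Sum.inr (w, j)))

/-- The standard setup: `G` is a connected graph with at least `2` edges and
`χ_la(G) = t ≥ 2`; `f` is a local antimagic labeling of `G` with `c(f) = t` whose color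
classes are `Vset 1, …, Vset t` (each nonempty, with `f⁺ ≡ c i` on `Vset i`, and the
colors `c 1, …, c t` pairwise distinct); every non-pendant vertex lies in
`Vset 1 ∪ ⋯ ∪ Vset r` where `1 ≤ r ≤ t`; each `Vset i` with `r + 1 ≤ i ≤ t` is a
singleton consisting of a pendant vertex; `c 1 < c 2 < ⋯ < c r` and
`c (r+1) < c (r+2) < ⋯ < c t`. -/
structure StandardSetup [Fintype V] (G : SimpleGraph V) (f : Sym2 V → ℕ)
    (t r : ℕ) (Vset : ℕ → Finset V) (c : ℕ → ℕ) : Prop where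
  connected : G.Connected
  two_le_card_edges : 2 ≤ G.edgeFinset.card
  chiLA_eq : chiLA G = t
  two_le_t : 2 ≤ t
  antimagic : IsLocalAntimagic G f
  colorCount_eq : colorCount G f = t
  color_on_class : ∀ i ∈ Finset.Icc 1 t, ∀ v ∈ Vset i, vertexSum G f v = c i
  class_cover : ∀ v : V, ∃ i ∈ Finset.Icc 1 t, v ∈ Vset i
  class_nonempty : ∀ i ∈ Finset.Icc 1 t, (Vset i).Nonempty
  color_injective : ∀ i ∈ Finset.Icc 1 t, ∀ j ∈ Finset.Icc 1 t, i ≠ j → c i ≠ c j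
  one_le_r : 1 ≤ r
  r_le_t : r ≤ t
  nonpendant_mem : ∀ v : V, ¬ IsPendant G v → ∃ i ∈ Finset.Icc 1 r, v ∈ Vset i
  pendant_singleton : ∀ i ∈ Finset.Icc (r + 1) t, ∃ v : V, IsPendant G v ∧ Vset i = {v}
  c_strictMono_low : ∀ i j : ℕ, 1 ≤ i → i < j → j ≤ r → c i < c j
  c_strictMono_high : ∀ i j : ℕ, r + 1 ≤ i → i < j → j ≤ t → c i < c j

/-- `b`: the number of pendant vertices of `G` lying in `Vset 1 ∪ ⋯ ∪ Vset r`. -/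
noncomputable def pendantsInLow [Fintype V] (G : SimpleGraph V)
    (Vset : ℕ → Finset V) (r : ℕ) : ℕ :=
  (((Finset.Icc 1 r).biUnion Vset).filter (fun v => IsPendant G v)).card

theorem vertexSum_eq_sum_ite [Fintype V] (G : SimpleGraph V) (f : Sym2 V → ℕ) (v : V) :
    vertexSum G f v = ∑ w, if G.Adj v w then f s(v, w) else 0 := by
  have h : G.incidenceFinset v = (univ.filter (G.Adj v)).image (fun w => s(v, w)) := by
    ext x
    induction x using Sym2.ind with
    | _ a b =>
      simp only [SimpleGraph.mem_incidenceFinset, SimpleGraph.mk'_mem_incidenceSet_iff, mem_image,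
        mem_filter, mem_univ, true_and]
      constructor
      · rintro ⟨hab, rfl | rfl⟩
        · exact ⟨b, hab, rfl⟩
        · exact ⟨a, hab.symm, Sym2.eq_swap⟩
      · rintro ⟨w, hw, hwe⟩
        rcases Sym2.eq_iff.1 hwe with ⟨rfl, rfl⟩ | ⟨rfl, rfl⟩
        · exact ⟨hw, Or.inl rfl⟩
        · exact ⟨hw.symm, Or.inr rfl⟩
  rw [vertexSum, h, sum_image, sum_filter]
  intro a _ b _ hab
  exact Sym2.congr_right.1 hab

theorem le_vertexSum [Fintype V] {G : SimpleGraph V} (f : Sym2 V → ℕ) {v w : V}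
    (h : G.Adj v w) : f s(v, w) ≤ vertexSum G f v := by
  rw [vertexSum_eq_sum_ite]
  simpa [h] using single_le_sum (f := fun w => if G.Adj v w then f s(v, w) else 0)
    (fun _ _ => Nat.zero_le _) (mem_univ w)

theorem IsPendant.exists_vertexSum_eq [Fintype V] {G : SimpleGraph V} {v : V}
    (hv : IsPendant G v) (f : Sym2 V → ℕ) : ∃ w, G.Adj v w ∧ vertexSum G f v = f s(v, w) := by
  obtain ⟨w, hw, huniq⟩ := SimpleGraph.degree_eq_one_iff_existsUnique_adj.1 hv
  refine ⟨w, hw, ?_⟩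
  rw [vertexSum_eq_sum_ite, sum_eq_single w]
  · simp [hw]
  · intro x _ hx
    exact if_neg fun hadj => hx (huniq x hadj)
  · simp

theorem lt_vertexSum_of_not_isPendant [Fintype V] {G : SimpleGraph V} {f : Sym2 V → ℕ}
    (hf : IsLocalAntimagic G f) {v w : V} (h : G.Adj v w) (hv : ¬ IsPendant G v) :
    f s(v, w) < vertexSum G f v := by
  obtain ⟨x, hx, hxw⟩ : ∃ x, G.Adj v x ∧ x ≠ w := by
    by_contra! hcon
    exact hv (SimpleGraph.degree_eq_one_iff_existsUnique_adj.2 ⟨w, h, hcon⟩)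
  have hpos : 1 ≤ f s(v, x) := (hf.1.mapsTo (show s(v, x) ∈ G.edgeSet from hx)).1
  have hle := sum_le_sum_of_subset (f := fun w => if G.Adj v w then f s(v, w) else 0)
    (subset_univ {x, w})
  rw [sum_pair hxw, ← vertexSum_eq_sum_ite] at hle
  simp only [h, hx, if_true] at hle
  omega

theorem IsLocalAntimagic.vertexSum_le_of_isPendant [Fintype V] {G : SimpleGraph V}
    {f : Sym2 V → ℕ} (hf : IsLocalAntimagic G f) {v : V} (hv : IsPendant G v) :
    vertexSum G f v ≤ G.edgeFinset.card := by
  obtain ⟨w, hw, hsum⟩ := hv.exists_vertexSum_eq f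
  rw [hsum]
  exact (hf.1.mapsTo (show s(v, w) ∈ G.edgeSet from hw)).2

theorem IsLocalAntimagic.injOn_pendants [Fintype V] {G : SimpleGraph V} {f : Sym2 V → ℕ}
    (hf : IsLocalAntimagic G f) : Set.InjOn (vertexSum G f) {v | IsPendant G v} := by
  intro u hu v hv huv
  obtain ⟨x, hx, hux⟩ := IsPendant.exists_vertexSum_eq hu f
  obtain ⟨y, hy, hvy⟩ := IsPendant.exists_vertexSum_eq hv f
  have h : s(u, x) = s(v, y) := hf.1.injOn hx hy (by rw [← hux, ← hvy, huv])
  rcases Sym2.eq_iff.1 h with ⟨h, _⟩ | ⟨_, rfl⟩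
  · exact h
  · exact absurd huv (hf.2 hx)

/-- Pendant colors are distinct and at most the number of edges, while an end of the edge with the
largest label has a color exceeding that number. -/
theorem IsLocalAntimagic.pendantCount_lt_colorCount [Fintype V] {G : SimpleGraph V}
    {f : Sym2 V → ℕ} (hf : IsLocalAntimagic G f) (hE : 1 ≤ G.edgeFinset.card) :
    pendantCount G < colorCount G f := by
  have hcard : pendantCount G
      = ((univ.filter fun v => IsPendant G v).image (vertexSum G f)).card := by
    rw [pendantCount, card_image_of_injOn]
    simpa using hf.injOn_pendants
  obtain ⟨x, hx, hmax⟩ := hf.1.surjOn (Set.mem_Icc.2 ⟨hE, le_rfl⟩)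
  obtain ⟨u, hu⟩ : ∃ u, G.edgeFinset.card < vertexSum G f u := by
    induction x using Sym2.ind with
    | _ a b =>
      have hab : G.Adj a b := hx
      by_cases ha : IsPendant G a
      · by_cases hb : IsPendant G b
        · have h1 := hf.vertexSum_le_of_isPendant ha
          have h2 := hf.vertexSum_le_of_isPendant hb
          have h3 := le_vertexSum f hab
          have h4 := le_vertexSum f hab.symm
          rw [Sym2.eq_swap] at h4
          exact absurd (by omega) (hf.2 hab)
        · refine ⟨b, ?_⟩
          rw [← hmax, Sym2.eq_swap]
          exact lt_vertexSum_of_not_isPendant hf hab.symm hb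
      · refine ⟨a, ?_⟩
        rw [← hmax]
        exact lt_vertexSum_of_not_isPendant hf hab ha
  rw [hcard, colorCount]
  refine card_lt_card ((ssubset_iff_of_subset (image_subset_image (subset_univ _))).2
    ⟨vertexSum G f u, mem_image_of_mem _ (mem_univ u), ?_⟩)
  simp only [mem_image, mem_filter, mem_univ, true_and, not_exists, not_and]
  intro v hv hvu
  have := hf.vertexSum_le_of_isPendant hv
  omega

section AttachPendants

variable {G : SimpleGraph V} {S : Finset V} {s : ℕ}

@[simp]
theorem attachPendants_adj_inl_inl {u v : V} :
    (attachPendants G S s).Adj (Sum.inl u) (Sum.inl v) ↔ G.Adj u v := by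
  simp only [attachPendants, SimpleGraph.fromRel_adj]
  constructor
  · rintro ⟨-, (⟨a, b, ha, hb, h⟩ | ⟨w, j, ha, hb⟩) | (⟨a, b, ha, hb, h⟩ | ⟨w, j, ha, hb⟩)⟩
    · cases ha; cases hb; exact h
    · cases hb
    · cases ha; cases hb; exact h.symm
    · cases hb
  · intro h
    exact ⟨fun he => h.ne (Sum.inl.inj he), Or.inl (Or.inl ⟨u, v, rfl, rfl, h⟩)⟩

@[simp]
theorem attachPendants_adj_inl_inr {u : V} {p : S × Fin s} :
    (attachPendants G S s).Adj (Sum.inl u) (Sum.inr p) ↔ u = p.1 := by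
  simp only [attachPendants, SimpleGraph.fromRel_adj]
  constructor
  · rintro ⟨-, (⟨a, b, ha, hb, h⟩ | ⟨w, j, ha, hb⟩) | (⟨a, b, ha, hb, h⟩ | ⟨w, j, ha, hb⟩)⟩
    · cases hb
    · cases ha; cases hb; rfl
    · cases ha
    · cases ha
  · rintro rfl
    exact ⟨by simp, Or.inl (Or.inr ⟨p.1, p.2, rfl, rfl⟩)⟩

@[simp]
theorem attachPendants_adj_inr_inl {u : V} {p : S × Fin s} :
    (attachPendants G S s).Adj (Sum.inr p) (Sum.inl u) ↔ u = p.1 := by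
  rw [SimpleGraph.adj_comm, attachPendants_adj_inl_inr]

@[simp]
theorem not_attachPendants_adj_inr_inr {p q : S × Fin s} :
    ¬ (attachPendants G S s).Adj (Sum.inr p) (Sum.inr q) := by
  simp [attachPendants, SimpleGraph.fromRel_adj]

theorem pendantCount_add_le_attachPendants [Fintype V] (hS : ∀ v ∈ S, ¬ IsPendant G v) :
    s * S.card + pendantCount G ≤ pendantCount (attachPendants G S s) := by
  have hsub : (univ.filter fun v => IsPendant G v).disjSum (univ : Finset (S × Fin s))
      ⊆ univ.filter fun v => IsPendant (attachPendants G S s) v := by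
    intro x hx
    rw [mem_filter]
    refine ⟨mem_univ _, SimpleGraph.degree_eq_one_iff_existsUnique_adj.2 ?_⟩
    rcases x with v | p
    · have hv : IsPendant G v := by simpa using hx
      obtain ⟨w, hw, huniq⟩ := SimpleGraph.degree_eq_one_iff_existsUnique_adj.1 hv
      refine ⟨Sum.inl w, attachPendants_adj_inl_inl.2 hw, ?_⟩
      rintro (y | q) hy
      · rw [huniq y (attachPendants_adj_inl_inl.1 hy)]
      · exact absurd hv (hS v (attachPendants_adj_inl_inr.1 hy ▸ q.1.2))
    · refine ⟨Sum.inl p.1, attachPendants_adj_inr_inl.2 rfl, ?_⟩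
      rintro (y | q) hy
      · rw [attachPendants_adj_inr_inl.1 hy]
      · exact absurd hy not_attachPendants_adj_inr_inr
  have := card_le_card hsub
  rw [card_disjSum, card_univ, Fintype.card_prod, Fintype.card_coe, Fintype.card_fin] at this
  rw [pendantCount, pendantCount, mul_comm]
  omega

/-- The labeling of `G(S, s)` that agrees with `f` on `G` and gives the new pendant edge at the
vertex `Sum.inr p` the label `g p`. -/
def extendLabel (f : Sym2 V → ℕ) (g : S × Fin s → ℕ) : Sym2 (V ⊕ (S × Fin s)) → ℕ :=
  Sym2.lift ⟨fun a b => match a, b with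
    | Sum.inl u, Sum.inl v => f s(u, v)
    | Sum.inl _, Sum.inr p => g p
    | Sum.inr p, Sum.inl _ => g p
    | Sum.inr _, Sum.inr _ => 0, by
    rintro (a | a) (b | b)
    · exact congrArg f Sym2.eq_swap
    · rfl
    · rfl
    · rfl⟩

variable (f : Sym2 V → ℕ) (g : S × Fin s → ℕ)

@[simp]
theorem extendLabel_inl_inl (u v : V) :
    extendLabel f g s(Sum.inl u, Sum.inl v) = f s(u, v) := rfl

@[simp]
theorem extendLabel_inl_inr (u : V) (p : S × Fin s) :
    extendLabel f g s(Sum.inl u, Sum.inr p) = g p := rfl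

@[simp]
theorem extendLabel_inr_inl (u : V) (p : S × Fin s) :
    extendLabel f g s(Sum.inr p, Sum.inl u) = g p := rfl

theorem vertexSum_extendLabel_inr [Fintype V] (p : S × Fin s) :
    vertexSum (attachPendants G S s) (extendLabel f g) (Sum.inr p) = g p := by
  rw [vertexSum_eq_sum_ite, Fintype.sum_sum_type]
  simp

theorem vertexSum_extendLabel_inl_of_notMem [Fintype V] {v : V} (hv : v ∉ S) :
    vertexSum (attachPendants G S s) (extendLabel f g) (Sum.inl v) = vertexSum G f v := by
  rw [vertexSum_eq_sum_ite, Fintype.sum_sum_type, vertexSum_eq_sum_ite]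
  have h : ∀ p : S × Fin s, v ≠ p.1 := fun p hp => hv (hp ▸ p.1.2)
  simp [h]

theorem vertexSum_extendLabel_inl_of_mem [Fintype V] (v : S) :
    vertexSum (attachPendants G S s) (extendLabel f g) (Sum.inl (v : V))
      = vertexSum G f v + ∑ j, g (v, j) := by
  rw [vertexSum_eq_sum_ite, Fintype.sum_sum_type, vertexSum_eq_sum_ite]
  congr 1
  · simp
  · rw [Fintype.sum_prod_type, sum_eq_single v]
    · simp
    · intro w _ hw
      have : (v : V) ≠ w := fun h => hw (Subtype.ext h.symm)
      simp [this]
    · simp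

theorem edgeSet_attachPendants :
    (attachPendants G S s).edgeSet = Sym2.map Sum.inl '' G.edgeSet ∪
      Set.range fun p : S × Fin s => s(Sum.inl (p.1 : V), Sum.inr p) := by
  ext x
  constructor
  · induction x using Sym2.ind with
    | _ a b =>
      intro h
      rw [SimpleGraph.mem_edgeSet] at h
      rcases a with a | a <;> rcases b with b | b
      · exact Or.inl ⟨s(a, b), attachPendants_adj_inl_inl.1 h, rfl⟩
      · exact Or.inr ⟨b, by rw [attachPendants_adj_inl_inr.1 h]⟩
      · exact Or.inr ⟨a, by rw [attachPendants_adj_inr_inl.1 h]; exact Sym2.eq_swap⟩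
      · exact absurd h not_attachPendants_adj_inr_inr
  · rintro (⟨y, hy, rfl⟩ | ⟨p, rfl⟩)
    · induction y using Sym2.ind with
      | _ a b => exact attachPendants_adj_inl_inl.2 hy
    · exact attachPendants_adj_inl_inr.2 rfl

variable {f g}

theorem bijOn_extendLabel {e N : ℕ} (heN : e ≤ N) (hf : Set.BijOn f G.edgeSet (Set.Icc 1 e))
    (hg : Set.BijOn g Set.univ (Set.Icc (e + 1) N)) :
    Set.BijOn (extendLabel f g) (attachPendants G S s).edgeSet (Set.Icc 1 N) := by
  have hcomp : ∀ y : Sym2 V, extendLabel f g (Sym2.map Sum.inl y) = f y :=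
    Sym2.ind fun _ _ => rfl
  rw [edgeSet_attachPendants]
  refine ⟨?_, ?_, ?_⟩
  · rintro _ (⟨y, hy, rfl⟩ | ⟨p, rfl⟩)
    · have := hf.mapsTo hy
      rw [hcomp]
      exact ⟨this.1, this.2.trans heN⟩
    · have := hg.mapsTo (Set.mem_univ p)
      simp only [Set.mem_Icc, extendLabel_inl_inr] at this ⊢
      omega
  · rintro _ (⟨y, hy, rfl⟩ | ⟨p, rfl⟩) _ (⟨z, hz, rfl⟩ | ⟨q, rfl⟩) h
    · rw [hcomp, hcomp] at h
      rw [hf.injOn hy hz h]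
    · have h1 := hf.mapsTo hy
      have h2 := hg.mapsTo (Set.mem_univ q)
      simp only [hcomp, Set.mem_Icc, extendLabel_inl_inr] at h h1 h2
      omega
    · have h1 := hf.mapsTo hz
      have h2 := hg.mapsTo (Set.mem_univ p)
      simp only [hcomp, Set.mem_Icc, extendLabel_inl_inr] at h h1 h2
      omega
    · simp only [extendLabel_inl_inr] at h
      rw [hg.injOn (Set.mem_univ p) (Set.mem_univ q) h]
  · rintro k ⟨hk1, hk2⟩
    by_cases hk : k ≤ e
    · obtain ⟨y, hy, rfl⟩ := hf.surjOn ⟨hk1, hk⟩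
      exact ⟨_, Or.inl ⟨y, hy, rfl⟩, hcomp y⟩
    · obtain ⟨p, -, rfl⟩ := hg.surjOn (show k ∈ Set.Icc (e + 1) N from ⟨by omega, hk2⟩)
      exact ⟨_, Or.inr ⟨p, rfl⟩, rfl⟩

end AttachPendants

theorem card_edgeFinset_of_bijOn [Fintype V] {G : SimpleGraph V} {f : Sym2 V → ℕ} {N : ℕ}
    (h : Set.BijOn f G.edgeSet (Set.Icc 1 N)) : G.edgeFinset.card = N := by
  have hcard := card_image_of_injOn (s := G.edgeFinset) (f := f) (by simpa using h.injOn)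
  have himg : G.edgeFinset.image f = Finset.Icc 1 N := by
    apply coe_injective
    rw [coe_image, SimpleGraph.coe_edgeFinset, h.image_eq, coe_Icc]
  rw [← hcard, himg]
  simp

/-- A boustrophedon `n × s` array of consecutive integers has equal row sums when `n ≤ 1` or `s`
is even. -/
theorem exists_bijOn_Icc_row_sum_eq {α : Type*} [Fintype α] (e s : ℕ)
    (h : Fintype.card α ≤ 1 ∨ Even s) :
    ∃ (g : α × Fin s → ℕ) (K : ℕ),
      Set.BijOn g Set.univ (Set.Icc (e + 1) (e + s * Fintype.card α)) ∧
      ∀ w, ∑ j, g (w, j) = K := by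
  set n := Fintype.card α with hn
  let φ : α ≃ Fin n := Fintype.equivFin α
  let d : ℕ → ℕ → ℕ := fun w j => if Even j then w else n - 1 - w
  have hd : ∀ w j, w < n → d w j < n := by
    intro w j hw
    simp only [d]
    split_ifs <;> omega
  let g : α × Fin s → ℕ := fun p => e + 1 + (n * p.2 + d (φ p.1) p.2)
  have hinj : Function.Injective g := by
    rintro ⟨w, j⟩ ⟨w', j'⟩ hg
    have hg' : n * j + d (φ w) j = n * j' + d (φ w') j' := by
      simp only [g] at hg
      omega
    have h1 := hd (φ w) j (φ w).2
    have h2 := hd (φ w') j' (φ w').2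
    have hj : (j : ℕ) = j' := by
      have := congrArg (· / n) hg'
      simpa [Nat.mul_add_div (Nat.zero_lt_of_lt h1), Nat.div_eq_of_lt h1,
        Nat.div_eq_of_lt h2] using this
    obtain rfl := Fin.ext hj
    have hw : (φ w : ℕ) = φ w' := by
      have h3 := (φ w).2
      have h4 := (φ w').2
      have h5 : d (φ w) j = d (φ w') j := by omega
      simp only [d] at h5
      split_ifs at h5 <;> omega
    rw [φ.injective (Fin.ext hw)]
  have hmaps : ∀ p, g p ∈ Finset.Icc (e + 1) (e + s * n) := by
    rintro ⟨w, j⟩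
    have h1 := hd (φ w) j (φ w).2
    have h2 : n * (j + 1) ≤ n * s := Nat.mul_le_mul_left n j.2
    simp only [mem_Icc, g]
    rw [mul_comm s n]
    rw [mul_add] at h2
    omega
  have himg : univ.image g = Finset.Icc (e + 1) (e + s * n) := by
    apply eq_of_subset_of_card_le
    · intro x hx
      obtain ⟨p, -, rfl⟩ := mem_image.1 hx
      exact hmaps p
    · rw [card_image_of_injective _ hinj, card_univ, Fintype.card_prod, Fintype.card_fin, ← hn,
        Nat.card_Icc, mul_comm s n]
      omega
  have hbij : Set.BijOn g Set.univ (Set.Icc (e + 1) (e + s * n)) := by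
    rw [← coe_Icc, ← himg, coe_image, coe_univ]
    exact hinj.injOn.bijOn_image
  suffices hrow : ∀ w w', ∑ j, g (w, j) = ∑ j, g (w', j) by
    by_cases hα : Nonempty α
    · exact ⟨g, ∑ j, g (hα.some, j), hbij, fun w => hrow _ _⟩
    · exact ⟨g, 0, hbij, fun w => (hα ⟨w⟩).elim⟩
  intro w w'
  rcases h with h | ⟨k, rfl⟩
  · rw [Fintype.card_le_one_iff.1 h w w']
  · have hpair : ∀ x : ℕ, x < n → ∀ m, ∑ j ∈ range (m + m), d x j = m * (n - 1) := by
      intro x hx m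
      induction m with
      | zero => simp
      | succ m ih =>
        have h1 : Even (m + m) := ⟨m, rfl⟩
        have h2 : ¬ Even (m + m + 1) := by simp [Nat.even_add_one, h1]
        rw [show m + 1 + (m + 1) = m + m + 1 + 1 by ring, sum_range_succ, sum_range_succ, ih]
        simp only [d, h1, h2, if_true, if_false, add_mul]
        omega
    have hsum : ∀ w, ∑ j : Fin (k + k), d (φ w) j = k * (n - 1) := fun w => by
      rw [Fin.sum_univ_eq_sum_range (fun j => d (φ w) j), hpair _ (φ w).2]
    simp only [g, sum_add_distrib, hsum]

namespace StandardSetup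

variable [Fintype V] {G : SimpleGraph V} {f : Sym2 V → ℕ} {t r : ℕ} {Vset : ℕ → Finset V}
  {c : ℕ → ℕ}

theorem disjoint_classes (setup : StandardSetup G f t r Vset c) {i j : ℕ}
    (hi : i ∈ Finset.Icc 1 t) (hj : j ∈ Finset.Icc 1 t) (hij : i ≠ j) :
    Disjoint (Vset i) (Vset j) := by
  rw [Finset.disjoint_left]
  intro v hvi hvj
  apply setup.color_injective i hi j hj hij
  rw [← setup.color_on_class i hi v hvi, setup.color_on_class j hj v hvj]

theorem pendantsInLow_add_le (setup : StandardSetup G f t r Vset c) :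
    pendantsInLow G Vset r + (t - r) ≤ pendantCount G := by
  have hr := setup.r_le_t
  have hhigh : ((Finset.Icc (r + 1) t).biUnion Vset).card = t - r := by
    rw [card_biUnion, sum_congr rfl (g := fun _ => 1)]
    · simp
    · intro i hi
      obtain ⟨v, -, hv⟩ := setup.pendant_singleton i hi
      rw [hv, card_singleton]
    · intro i hi j hj hij
      simp only [coe_Icc, Set.mem_Icc] at hi hj
      exact setup.disjoint_classes (by simp; omega) (by simp; omega) hij
  have hdisj : Disjoint (((Finset.Icc 1 r).biUnion Vset).filter fun v => IsPendant G v)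
      ((Finset.Icc (r + 1) t).biUnion Vset) := by
    refine Disjoint.mono_left (filter_subset _ _) ?_
    rw [disjoint_biUnion_left]
    intro i hi
    rw [disjoint_biUnion_right]
    intro j hj
    rw [mem_Icc] at hi hj
    exact setup.disjoint_classes (by simp; omega) (by simp; omega) (by omega)
  rw [pendantsInLow, ← hhigh, ← card_union_of_disjoint hdisj, pendantCount]
  apply card_le_card
  intro v hv
  rw [mem_filter]
  refine ⟨mem_univ _, ?_⟩
  rcases mem_union.1 hv with hv | hv
  · exact (mem_filter.1 hv).2
  · obtain ⟨i, hi, hvi⟩ := mem_biUnion.1 hv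
    obtain ⟨w, hw, hwi⟩ := setup.pendant_singleton i hi
    rw [hwi, mem_singleton] at hvi
    exact hvi ▸ hw

theorem color_high_le (setup : StandardSetup G f t r Vset c) {i : ℕ}
    (hi : i ∈ Finset.Icc (r + 1) t) : c i ≤ G.edgeFinset.card := by
  obtain ⟨v, hv, hvi⟩ := setup.pendant_singleton i hi
  rw [mem_Icc] at hi
  rw [← setup.color_on_class i (by simp; omega) v (by simp [hvi])]
  exact setup.antimagic.vertexSum_le_of_isPendant hv

theorem color_le_of_ne (setup : StandardSetup G f t r Vset c) {i j B : ℕ} (hi₂ : i ≤ r)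
    (hi : i < r → c r ≤ B) (hi' : i = r → c (r - 1) ≤ B) (hB : G.edgeFinset.card ≤ B)
    (hj : j ∈ Finset.Icc 1 t) (hji : j ≠ i) : c j ≤ B := by
  rw [mem_Icc] at hj
  by_cases hjr : j ≤ r
  · have hmono : ∀ k, j ≤ k → k ≤ r → c j ≤ c k := by
      intro k hjk hkr
      rcases hjk.eq_or_lt with rfl | hlt
      · exact le_rfl
      · exact (setup.c_strictMono_low j k hj.1 hlt hkr).le
    rcases hi₂.lt_or_eq with h | h
    · exact (hmono r hjr le_rfl).trans (hi h)
    · exact (hmono (r - 1) (by omega) (by omega)).trans (hi' h)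
  · exact (setup.color_high_le (mem_Icc.2 ⟨by omega, hj.2⟩)).trans hB

end StandardSetup

/-- Theorem 2.1(2), second part: in the standard setup with `r ≥ 2`,
for `2 ≤ i ≤ r`, if `e + s·nᵢ ≥ c_r` when `i < r` and `e + s·nᵢ ≥ c_{r-1}` when
`i = r`, where `s ≥ 1` if `nᵢ = 1` and `s ≥ 2` is even if `nᵢ ≥ 2`, and `c₁ ≤ e < c₂`,
then `s·nᵢ + t - r + b + 1 ≤ χ_la(G(Vᵢ, s)) ≤ s·nᵢ + t - r + 2`. -/
theorem chiLA_attachPendants_bounds_c1_le [Fintype V] (G : SimpleGraph V)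
    (f : Sym2 V → ℕ) (t r : ℕ) (Vset : ℕ → Finset V) (c : ℕ → ℕ)
    (setup : StandardSetup G f t r Vset c) (hr : 2 ≤ r)
    (e s i b : ℕ) (he : G.edgeFinset.card = e)
    (hb : pendantsInLow G Vset r = b)
    (hi₁ : 2 ≤ i) (hi₂ : i ≤ r)
    (hbig₁ : i < r → c r ≤ e + s * (Vset i).card)
    (hbig₂ : i = r → c (r - 1) ≤ e + s * (Vset i).card)
    (hs₁ : (Vset i).card = 1 → 1 ≤ s)
    (hs₂ : 2 ≤ (Vset i).card → 2 ≤ s ∧ Even s)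
    (hce₁ : c 1 ≤ e) (hce₂ : e < c 2) :
    s * (Vset i).card + (t - r) + b + 1 ≤ chiLA (attachPendants G (Vset i) s) ∧
    chiLA (attachPendants G (Vset i) s) ≤ s * (Vset i).card + (t - r) + 2 := by
  subst he hb
  set e := G.edgeFinset.card with he
  have hit : i ∈ Finset.Icc 1 t := mem_Icc.2 ⟨by omega, hi₂.trans setup.r_le_t⟩
  have hlow : ∀ j, 2 ≤ j → j ≤ r → e < c j := by
    intro j h2 hj
    rcases h2.eq_or_lt with rfl | hlt
    · exact hce₂
    · exact hce₂.trans (setup.c_strictMono_low 2 j (by omega) hlt hj)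
  have hci := hlow i hi₁ hi₂
  have hnp : ∀ v ∈ Vset i, ¬ IsPendant G v := by
    intro v hv hp
    have h1 := setup.antimagic.vertexSum_le_of_isPendant hp
    rw [setup.color_on_class i hit v hv] at h1
    omega
  have hn : 1 ≤ (Vset i).card := card_pos.2 (setup.class_nonempty i hit)
  have hs : 1 ≤ s ∧ ((Vset i).card ≤ 1 ∨ Even s) := by
    rcases hn.eq_or_lt with h | h
    · exact ⟨hs₁ h.symm, Or.inl h.ge⟩
    · exact ⟨by have := (hs₂ h).1; omega, Or.inr (hs₂ h).2⟩
  obtain ⟨g, K, hg, hrow⟩ := exists_bijOn_Icc_row_sum_eq (α := Vset i) e s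
    (by rw [Fintype.card_coe]; exact hs.2)
  rw [Fintype.card_coe] at hg
  set N := e + s * (Vset i).card with hN
  have hbij := bijOn_extendLabel (Nat.le_add_right _ _) setup.antimagic.1 hg
  have hcard := card_edgeFinset_of_bijOn hbij
  have hcj : ∀ j ∈ Finset.Icc 1 t, j ≠ i → c j ≤ N := fun j hj hji =>
    setup.color_le_of_ne hi₂ hbig₁ hbig₂ (Nat.le_add_right _ _) hj hji
  have hgK : ∀ p, g p ≤ K := by
    rintro ⟨w, j⟩
    rw [← hrow w]
    exact single_le_sum (f := fun j => g (w, j)) (fun _ _ => Nat.zero_le _) (mem_univ j)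
  have hNK : N ≤ K := by
    have hpos : 1 ≤ s * (Vset i).card := Nat.mul_pos hs.1 hn
    obtain ⟨p, -, hp⟩ := hg.surjOn (show N ∈ Set.Icc (e + 1) N from ⟨by omega, le_rfl⟩)
    exact hp ▸ hgK p
  have hin : ∀ v ∈ Vset i, vertexSum (attachPendants G (Vset i) s) (extendLabel f g)
      (Sum.inl v) = c i + K := by
    intro v hv
    rw [vertexSum_extendLabel_inl_of_mem f g ⟨v, hv⟩, hrow, setup.color_on_class i hit v hv]
  have hout : ∀ v ∉ Vset i, ∃ j ∈ Finset.Icc 1 t, j ≠ i ∧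
      vertexSum (attachPendants G (Vset i) s) (extendLabel f g) (Sum.inl v) = c j := by
    intro v hv
    obtain ⟨j, hj, hvj⟩ := setup.class_cover v
    refine ⟨j, hj, fun h => hv (h ▸ hvj), ?_⟩
    rw [vertexSum_extendLabel_inl_of_notMem f g hv, setup.color_on_class j hj v hvj]
  have hanti : IsLocalAntimagic (attachPendants G (Vset i) s) (extendLabel f g) := by
    refine ⟨by rwa [hcard], ?_⟩
    rintro (u | p) (v | q) h
    · rw [attachPendants_adj_inl_inl] at h
      have hne := setup.antimagic.2 h
      by_cases hu : u ∈ Vset i <;> by_cases hv : v ∈ Vset i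
      · rw [setup.color_on_class i hit u hu, setup.color_on_class i hit v hv] at hne
        exact absurd rfl hne
      · obtain ⟨j, hj, hji, hjv⟩ := hout v hv
        rw [hin u hu, hjv]
        have := hcj j hj hji
        omega
      · obtain ⟨j, hj, hji, hju⟩ := hout u hu
        rw [hin v hv, hju]
        have := hcj j hj hji
        omega
      · rwa [vertexSum_extendLabel_inl_of_notMem f g hu,
          vertexSum_extendLabel_inl_of_notMem f g hv]
    · rw [attachPendants_adj_inl_inr] at h
      rw [vertexSum_extendLabel_inr, hin u (h ▸ q.1.2)]
      have := hgK q
      omega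
    · rw [attachPendants_adj_inr_inl] at h
      rw [vertexSum_extendLabel_inr, hin v (h ▸ p.1.2)]
      have := hgK p
      omega
    · exact absurd h not_attachPendants_adj_inr_inr
  constructor
  · refine le_csInf ⟨_, _, hanti, rfl⟩ ?_
    rintro _ ⟨f', hf', rfl⟩
    have h1 := hf'.pendantCount_lt_colorCount
      (by rw [hcard]; have := setup.two_le_card_edges; omega)
    have h2 := pendantCount_add_le_attachPendants (G := G) (s := s) hnp
    have h3 := setup.pendantsInLow_add_le
    omega
  · have hle : chiLA (attachPendants G (Vset i) s) ≤
        colorCount (attachPendants G (Vset i) s) (extendLabel f g) :=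
      Nat.sInf_le ⟨_, hanti, rfl⟩
    refine hle.trans ?_
    have hsub : univ.image (vertexSum (attachPendants G (Vset i) s) (extendLabel f g)) ⊆
        (Finset.Icc (e + 1) N ∪ (Finset.Icc (r + 1) t).image c) ∪ {c 1, c i + K} := by
      intro x hx
      obtain ⟨v, -, rfl⟩ := mem_image.1 hx
      rcases v with v | p
      · by_cases hv : v ∈ Vset i
        · simp [hin v hv]
        · obtain ⟨j, hj, hji, hjv⟩ := hout v hv
          have hjN := hcj j hj hji
          rw [mem_Icc] at hj
          rw [hjv]
          rcases hj.1.eq_or_lt with rfl | hj1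
          · simp
          · refine mem_union_left _ ?_
            by_cases hjr : j ≤ r
            · exact mem_union_left _ (mem_Icc.2 ⟨hlow j hj1 hjr, hjN⟩)
            · exact mem_union_right _ (mem_image_of_mem c (mem_Icc.2 ⟨by omega, hj.2⟩))
      · rw [vertexSum_extendLabel_inr]
        have := hg.mapsTo (Set.mem_univ p)
        exact mem_union_left _ (mem_union_left _ (mem_Icc.2 this))
    have h1 := card_le_card hsub
    have h2 := card_union_le (Finset.Icc (e + 1) N ∪ (Finset.Icc (r + 1) t).image c)
      {c 1, c i + K}
    have h3 := card_union_le (Finset.Icc (e + 1) N) ((Finset.Icc (r + 1) t).image c)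
    have h4 := card_image_le (s := Finset.Icc (r + 1) t) (f := c)
    have h5 := card_le_two (a := c 1) (b := c i + K)
    rw [Nat.card_Icc] at h3 h4
    rw [colorCount]
    omega

end LocalAntimagic
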